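/- arXiv:1712.03639 — 3 statements merged into one kernel-verified Lean document; each statement's English description precedes it below -/
import Mathlib

section
/- Let n and r be positive integers with r dividing n, and let σ, π ∈ S_n. Then the r-regular Ulam distance d∘(m_σ^r, m_π^r) = n − ℓ(m_σ^r, m_π^r) equals the minimum k ≥ 0 such that there exist translocations φ_1, …, φ_k ∈ S_n with m_σ^r · φ_1 φ_2 ⋯ φ_k = m_π^r. -/
/-- Length of a longest common subsequence of two lists. -/
noncomputable def lcsLen {α : Type*} (x y : List α) : ℕ :=
  sSup {k | ∃ z : List α, z.length = k ∧ z.Sublist x ∧ z.Sublist y}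
/-- The `r`-regular multipermutation `m_σ^r` of `σ`, with values in `{1, …, n/r}`:
`m_σ^r(i) = j` iff `(j-1)r + 1 ≤ σ(i) ≤ jr` (with `σ(i)` read as a 1-indexed value). -/
def mreg {n : ℕ} (r : ℕ) (σ : Equiv.Perm (Fin n)) : Fin n → ℕ :=
  fun i => (σ i : ℕ) / r + 1
/-- The `r`-regular Ulam distance between length-`n` sequences:
`n` minus the length of a longest common subsequence. -/
noncomputable def mdist {n : ℕ} {α : Type*} (x y : Fin n → α) : ℕ :=
  n - lcsLen (List.ofFn x) (List.ofFn y)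
/-- The translocation `φ(i,j)` (0-indexed): for `i ≤ j` it is the cycle
`(i, i+1, …, j)`, sending `k ↦ k+1` for `i ≤ k < j`, `j ↦ i`, and fixing all other
elements (so `φ(i,i)` is the identity); for `i > j` it is the inverse of `φ(j,i)`,
sending `j ↦ i` and `k ↦ k-1` for `j < k ≤ i`. -/
def transloc {n : ℕ} (i j : Fin n) : Equiv.Perm (Fin n) :=
  if i ≤ j then
    (finRotate n ^ (i : ℕ)) * Fin.cycleRange (j - i) * (finRotate n ^ (i : ℕ))⁻¹
  else
    ((finRotate n ^ (j : ℕ)) * Fin.cycleRange (i - j) * (finRotate n ^ (j : ℕ))⁻¹)⁻¹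

theorem le_lcsLen {α : Type*} {x y z : List α} (hx : z.Sublist x) (hy : z.Sublist y) :
    z.length ≤ lcsLen x y :=
  le_csSup ⟨x.length, by rintro k ⟨w, rfl, hw, -⟩; exact hw.length_le⟩ ⟨z, rfl, hx, hy⟩

theorem exists_sublist_length_eq_lcsLen {α : Type*} (x y : List α) :
    ∃ z : List α, z.length = lcsLen x y ∧ z.Sublist x ∧ z.Sublist y :=
  Nat.sSup_mem (s := {k | ∃ z : List α, z.length = k ∧ z.Sublist x ∧ z.Sublist y})
    ⟨0, [], rfl, List.nil_sublist _, List.nil_sublist _⟩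
    ⟨x.length, by rintro k ⟨w, rfl, hw, -⟩; exact hw.length_le⟩

theorem List.Sublist.exists_sublist_eraseIdx {α : Type*} {z l : List α} (h : z.Sublist l)
    (j : ℕ) : ∃ w : List α, w.Sublist z ∧ w.Sublist (l.eraseIdx j) ∧ z.length ≤ w.length + 1 := by
  induction h generalizing j with
  | slnil => exact ⟨[], by simp⟩
  | @cons l₁ l₂ a h ih =>
    cases j with
    | zero => exact ⟨l₁, List.Sublist.refl _, by simpa using h, by simp⟩
    | succ j =>
      obtain ⟨w, h₁, h₂, h₃⟩ := ih j
      exact ⟨w, h₁, by simpa using h₂.cons a, h₃⟩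
  | @cons_cons l₁ l₂ a h ih =>
    cases j with
    | zero => exact ⟨l₁, List.sublist_cons_self _ _, by simpa using h, by simp⟩
    | succ j =>
      obtain ⟨w, h₁, h₂, h₃⟩ := ih j
      exact ⟨a :: w, h₁.cons_cons a, by simpa using h₂.cons_cons a, by simpa using h₃⟩

/-- If `z` embeds in `l` but uses fewer copies of `b`, some copy of `b` in `l` is unused. -/
theorem List.Sublist.exists_eq_append_cons_of_count_lt {α : Type*} [DecidableEq α]
    {z l : List α} (h : z.Sublist l) {b : α} (hb : z.count b < l.count b) :
    ∃ p q : List α, l = p ++ b :: q ∧ z.Sublist (p ++ q) := by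
  induction h with
  | slnil => simp at hb
  | @cons l₁ l₂ a h ih =>
    by_cases hab : a = b
    · exact ⟨[], l₂, by simp [hab], h⟩
    · rw [List.count_cons_of_ne hab] at hb
      obtain ⟨p, q, rfl, hz⟩ := ih hb
      exact ⟨a :: p, q, rfl, hz.cons a⟩
  | @cons_cons l₁ l₂ a h ih =>
    obtain ⟨p, q, rfl, hz⟩ := ih (by simpa [List.count_cons] using hb)
    exact ⟨a :: p, q, rfl, hz.cons_cons a⟩

/-- A proper sublist can be enlarged by one entry inside the ambient list. -/
theorem List.Sublist.exists_append_cons_sublist {α : Type*} {z l : List α} (h : z.Sublist l)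
    (hlt : z.length < l.length) :
    ∃ (u v : List α) (b : α), z = u ++ v ∧ (u ++ b :: v).Sublist l := by
  induction h with
  | slnil => simp at hlt
  | @cons l₁ l₂ a h ih => exact ⟨[], l₁, a, rfl, h.cons_cons a⟩
  | @cons_cons l₁ l₂ a h ih =>
    obtain ⟨u, v, b, rfl, hs⟩ := ih (by simpa using hlt)
    exact ⟨a :: u, v, b, rfl, hs.cons_cons a⟩

theorem val_finRotate_pow {n : ℕ} (k : ℕ) (i : Fin n) :
    ((finRotate n ^ k) i : ℕ) = (i + k) % n := by
  obtain _ | n := n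
  · exact i.elim0
  induction k with
  | zero => simp [Nat.mod_eq_of_lt i.isLt]
  | succ k ih =>
    rw [pow_succ', Equiv.Perm.mul_apply, finRotate_apply, Fin.val_add, ih]
    simp [← add_assoc]

theorem val_cycleRange {n : ℕ} (i k : Fin n) :
    (Fin.cycleRange i k : ℕ) = if k < i then (k : ℕ) + 1 else if k = i then 0 else k := by
  split_ifs with h₁ h₂
  · exact Fin.coe_cycleRange_of_lt h₁
  · obtain _ | n := n
    · exact i.elim0
    · simp [Fin.cycleRange_of_eq h₂]
  · rw [Fin.cycleRange_of_gt (lt_of_le_of_ne (not_lt.1 h₁) (Ne.symm h₂))]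

theorem val_finRotate_pow_conj_cycleRange {n : ℕ} {i j : Fin n} (h : i ≤ j) (k : Fin n) :
    ((finRotate n ^ (i : ℕ) * Fin.cycleRange (j - i) * (finRotate n ^ (i : ℕ))⁻¹) k : ℕ) =
      if i ≤ k ∧ k < j then (k : ℕ) + 1 else if k = j then (i : ℕ) else k := by
  have hi := i.isLt
  have hj := j.isLt
  have hk := k.isLt
  obtain ⟨m, rfl⟩ := (finRotate n ^ (i : ℕ)).surjective k
  have hm := m.isLt
  have hval := val_finRotate_pow (i : ℕ) m
  rw [Equiv.Perm.mul_apply, Equiv.Perm.inv_def, Equiv.symm_apply_apply,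
    Equiv.Perm.mul_apply, val_finRotate_pow, val_cycleRange]
  simp only [Fin.lt_def, Fin.le_def, Fin.ext_iff, hval, Fin.sub_val_of_le h] at *
  rcases Nat.lt_or_ge (m + i) n with hlt | hge
  · rw [Nat.mod_eq_of_lt hlt]
    split_ifs <;> first | omega | (rw [Nat.mod_eq_of_lt (by omega)] <;> omega)
  · rw [Nat.mod_eq_sub_mod hge, Nat.mod_eq_of_lt (by omega : (m : ℕ) + i - n < n)]
    split_ifs <;> first | omega |
      (rw [Nat.mod_eq_sub_mod hge, Nat.mod_eq_of_lt (by omega)])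

theorem val_transloc {n : ℕ} (i j k : Fin n) :
    (transloc i j k : ℕ) =
      if k = j then (i : ℕ) else if i ≤ k ∧ k < j then (k : ℕ) + 1
      else if j < k ∧ k ≤ i then (k : ℕ) - 1 else k := by
  unfold transloc
  by_cases h : i ≤ j
  · rw [if_pos h, val_finRotate_pow_conj_cycleRange h]
    simp only [Fin.lt_def, Fin.le_def, Fin.ext_iff] at *
    split_ifs <;> omega
  · rw [if_neg h]
    have hconj := val_finRotate_pow_conj_cycleRange (le_of_not_ge h)
    generalize finRotate n ^ (j : ℕ) * Fin.cycleRange (i - j) * (finRotate n ^ (j : ℕ))⁻¹ = c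
      at hconj ⊢
    obtain ⟨m, rfl⟩ := c.surjective k
    rw [Equiv.Perm.inv_def, Equiv.symm_apply_apply]
    have hm := hconj m
    simp only [Fin.lt_def, Fin.le_def, Fin.ext_iff] at *
    split_ifs at hm ⊢ <;> omega

theorem ofFn_comp_transloc {n : ℕ} {α : Type*} (x : Fin n → α) (i j : Fin n) :
    List.ofFn (x ∘ transloc i j) = ((List.ofFn x).eraseIdx i).insertIdx j (x i) := by
  have hi := i.isLt
  have hj := j.isLt
  apply List.ext_getElem
  · rw [List.length_insertIdx_of_le_length, List.length_eraseIdx_of_lt] <;>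
      simp [List.length_eraseIdx] <;> omega
  · intro k h₁ h₂
    have hk : k < n := by simpa using h₁
    have hv := val_transloc i j ⟨k, hk⟩
    simp only [Fin.lt_def, Fin.le_def, Fin.ext_iff] at hv
    rw [List.getElem_insertIdx]
    simp only [List.getElem_ofFn, List.getElem_eraseIdx, Function.comp_apply]
    split_ifs <;> congr 1 <;> apply Fin.ext <;> rw [hv] <;> split_ifs <;> simp <;> omega

theorem eraseIdx_ofFn_comp_transloc {n : ℕ} {α : Type*} (x : Fin n → α) (i j : Fin n) :
    (List.ofFn (x ∘ transloc i j)).eraseIdx j = (List.ofFn x).eraseIdx i := by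
  rw [ofFn_comp_transloc, List.eraseIdx_insertIdx_self]

theorem exists_ofFn_comp_transloc_eq {n : ℕ} {α : Type*} {x : Fin n → α} {p q u v : List α}
    {b : α} (hx : List.ofFn x = p ++ b :: q) (hpq : p ++ q = u ++ v) :
    ∃ i j : Fin n, List.ofFn (x ∘ transloc i j) = u ++ b :: v := by
  have hn : n = p.length + (q.length + 1) := by simpa using congrArg List.length hx
  have hlen : p.length + q.length = u.length + v.length := by
    simpa using congrArg List.length hpq
  refine ⟨⟨p.length, by omega⟩, ⟨u.length, by omega⟩, ?_⟩
  have hb : x ⟨p.length, by omega⟩ = b := by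
    have h : (List.ofFn x)[p.length]? = some b := by rw [hx]; simp
    rw [List.getElem?_eq_getElem (by simp; omega)] at h
    simpa using h
  rw [ofFn_comp_transloc, hb, hx]
  have hins : (u ++ v).insertIdx u.length b = u ++ b :: v := by
    clear * -
    induction u <;> simp_all
  simp [List.eraseIdx_append_of_length_le, hpq, hins]

theorem exists_common_sublist_of_comp_prod_eq {n : ℕ} {α : Type*} {y : Fin n → α}
    (φs : List (Equiv.Perm (Fin n))) (hφ : ∀ φ ∈ φs, ∃ i j : Fin n, φ = transloc i j)
    (x : Fin n → α) (h : x ∘ ⇑φs.prod = y) :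
    ∃ z : List α, z.Sublist (List.ofFn x) ∧ z.Sublist (List.ofFn y) ∧
      n ≤ z.length + φs.length := by
  induction φs generalizing x with
  | nil =>
    obtain rfl : x = y := by simpa using h
    exact ⟨List.ofFn x, List.Sublist.refl _, List.Sublist.refl _, by simp⟩
  | cons φ φs ih =>
    obtain ⟨i, j, rfl⟩ := hφ φ List.mem_cons_self
    obtain ⟨z, hzx, hzy, hz⟩ := ih (fun ψ hψ => hφ ψ (List.mem_cons_of_mem _ hψ))
      (x ∘ transloc i j) (by rw [← h, List.prod_cons, Equiv.Perm.coe_mul, Function.comp_assoc])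
    obtain ⟨w, hwz, hw, hlen⟩ := hzx.exists_sublist_eraseIdx j
    rw [eraseIdx_ofFn_comp_transloc] at hw
    exact ⟨w, hw.trans (List.eraseIdx_sublist _ _), hwz.trans hzy,
      by rw [List.length_cons]; omega⟩

theorem exists_comp_prod_eq_of_common_sublist {n : ℕ} {α : Type*} {y : Fin n → α} (d : ℕ)
    (x : Fin n → α) (hxy : (List.ofFn x).Perm (List.ofFn y)) {z : List α}
    (hzx : z.Sublist (List.ofFn x)) (hzy : z.Sublist (List.ofFn y)) (hd : n = z.length + d) :
    ∃ φs : List (Equiv.Perm (Fin n)), φs.length = d ∧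
      (∀ φ ∈ φs, ∃ i j : Fin n, φ = transloc i j) ∧ x ∘ ⇑φs.prod = y := by
  classical
  induction d generalizing x z with
  | zero =>
    have h₁ := hzx.eq_of_length (by simpa using hd.symm)
    have h₂ := hzy.eq_of_length (by simpa using hd.symm)
    exact ⟨[], rfl, by simp, by simpa using List.ofFn_injective (h₁.symm.trans h₂)⟩
  | succ d ih =>
    obtain ⟨z₁, z₂, b, rfl, hs⟩ := hzy.exists_append_cons_sublist (by simp; omega)
    have hcount : (z₁ ++ z₂).count b < (List.ofFn x).count b := by
      have := hs.count_le b
      rw [hxy.count_eq]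
      simp at this ⊢
      omega
    obtain ⟨p, q, hpq, hsub⟩ := hzx.exists_eq_append_cons_of_count_lt hcount
    obtain ⟨u, v, huv, hu, hv⟩ := List.append_sublist_iff.1 hsub
    obtain ⟨i, j, hij⟩ := exists_ofFn_comp_transloc_eq hpq huv
    obtain ⟨φs, hlen, hφs, hprod⟩ := ih (x ∘ transloc i j)
      (((Equiv.Perm.ofFn_comp_perm (transloc i j) x)).trans hxy) (z := z₁ ++ b :: z₂)
      (by rw [hij]; exact hu.append (hv.cons_cons b)) hs
      (by simp at hd ⊢; omega)
    refine ⟨transloc i j :: φs, by simp [hlen], ?_, ?_⟩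
    · rintro φ (_ | ⟨_, hφ⟩)
      exacts [⟨i, j, rfl⟩, hφs φ hφ]
    · rw [← hprod, List.prod_cons, Equiv.Perm.coe_mul, Function.comp_assoc]

/-- The `r`-regular Ulam distance `d∘(m_σ^r, m_π^r) = n - ℓ(m_σ^r, m_π^r)`
equals the minimum number `k` of translocations `φ_1, …, φ_k` with
`m_σ^r · φ_1 φ_2 ⋯ φ_k = m_π^r` (where `m · π = m ∘ π`). -/
theorem rRegularUlamDist_eq_min_translocations (n r : ℕ) (hn : 0 < n) (hr : 0 < r)
    (hdvd : r ∣ n) (σ π : Equiv.Perm (Fin n)) :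
    sInf {k : ℕ | ∃ φs : List (Equiv.Perm (Fin n)), φs.length = k ∧
        (∀ φ ∈ φs, ∃ i j : Fin n, φ = transloc i j) ∧
        mreg r σ ∘ ⇑φs.prod = mreg r π} =
      mdist (mreg r σ) (mreg r π) := by
  obtain ⟨z, hz, hzσ, hzπ⟩ :=
    exists_sublist_length_eq_lcsLen (List.ofFn (mreg r σ)) (List.ofFn (mreg r π))
  have hperm : (List.ofFn (mreg r σ)).Perm (List.ofFn (mreg r π)) := by
    have h : mreg r π = mreg r σ ∘ ⇑(σ⁻¹ * π) := by
      funext i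
      simp [mreg]
    rw [h]
    exact (Equiv.Perm.ofFn_comp_perm _ _).symm
  have hle : z.length ≤ n := by simpa using hzσ.length_le
  have hmem := exists_comp_prod_eq_of_common_sublist (mdist (mreg r σ) (mreg r π)) (mreg r σ)
    hperm hzσ hzπ (by unfold mdist; omega)
  refine le_antisymm (Nat.sInf_le hmem) (le_csInf ⟨_, hmem⟩ ?_)
  rintro k ⟨φs, rfl, hφs, hprod⟩
  obtain ⟨w, hwσ, hwπ, hw⟩ := exists_common_sublist_of_comp_prod_eq φs hφs _ hprod
  have := le_lcsLen hwσ hwπ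
  unfold mdist
  omega
end

section
/- Let n > 5 be an integer and σ ∈ S_n. Then the permutation Ulam sphere of radius 3 centered at σ has size |S(σ, 3)| = 1 + (n−1)² + (n(n−3)/2)² + ((n−1)(n−2)/2)² + (n(n−1)(n−5)/6)² + (n(n−2)(n−4)/3)² + ((n−1)(n−2)(n−3)/6)². -/
/-- The sequence `(σ(1), …, σ(n))` associated with a permutation `σ ∈ S_n`
(positions are 0-indexed here, values 1-indexed). -/
def permSeq {n : ℕ} (σ : Equiv.Perm (Fin n)) : List ℕ :=
  List.ofFn fun i => (σ i : ℕ) + 1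

/-- The Ulam distance `d∘(σ,π) = n - ℓ(σ,π)` between permutations. -/
noncomputable def pdist {n : ℕ} (σ π : Equiv.Perm (Fin n)) : ℕ :=
  n - lcsLen (permSeq σ) (permSeq π)

/-- The permutation Ulam sphere of radius `t` centered at `σ`. -/
noncomputable def psphere {n : ℕ} (σ : Equiv.Perm (Fin n)) (t : ℕ) :
    Set (Equiv.Perm (Fin n)) :=
  {π | pdist σ π ≤ t}

/-- `S` indexes an increasing subsequence of `τ` with values below `j`. -/
def IsIncBelow {n : ℕ} (τ : Equiv.Perm (Fin n)) (j : ℕ) (S : Finset (Fin n)) : Prop :=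
  StrictMonoOn τ (S : Set (Fin n)) ∧ ∀ i ∈ S, (τ i : ℕ) < j

open Classical in
/-- Length of a longest increasing subsequence of `τ` with values below `j`. -/
noncomputable def lisBelow {n : ℕ} (τ : Equiv.Perm (Fin n)) (j : ℕ) : ℕ :=
  (Finset.univ.filter (IsIncBelow τ j)).sup Finset.card

theorem IsIncBelow.card_le {n : ℕ} {τ : Equiv.Perm (Fin n)} {j : ℕ} {S : Finset (Fin n)}
    (h : IsIncBelow τ j S) : S.card ≤ lisBelow τ j := by
  classical
  exact Finset.le_sup (f := Finset.card) (by simpa using h)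

theorem exists_isIncBelow_card_eq {n : ℕ} (τ : Equiv.Perm (Fin n)) (j : ℕ) :
    ∃ S, IsIncBelow τ j S ∧ S.card = lisBelow τ j := by
  classical
  obtain ⟨S, hS, h⟩ := Finset.exists_mem_eq_sup (Finset.univ.filter (IsIncBelow τ j))
    ⟨∅, by simp [IsIncBelow, StrictMonoOn]⟩ Finset.card
  exact ⟨S, by simpa using hS, h.symm⟩

/-- The permutation ending in `v` whose other entries are order-isomorphic to `τ`. -/
noncomputable def snocPerm {n : ℕ} (v : Fin (n + 1)) (τ : Equiv.Perm (Fin n)) :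
    Equiv.Perm (Fin (n + 1)) :=
  Equiv.ofBijective (Fin.snoc (α := fun _ => Fin (n + 1)) (fun i => v.succAbove (τ i)) v) <| by
    refine Function.Injective.bijective_of_finite fun a b => ?_
    induction a using Fin.lastCases <;> induction b using Fin.lastCases <;>
      simp [Fin.succAbove_ne, (Fin.succAbove_ne _ _).symm]

@[simp] theorem snocPerm_last {n : ℕ} (v : Fin (n + 1)) (τ : Equiv.Perm (Fin n)) :
    snocPerm v τ (Fin.last n) = v := by
  simp [snocPerm]

@[simp] theorem snocPerm_castSucc {n : ℕ} (v : Fin (n + 1)) (τ : Equiv.Perm (Fin n))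
    (i : Fin n) : snocPerm v τ i.castSucc = v.succAbove (τ i) := by
  simp [snocPerm]

theorem snocPerm_bijective (n : ℕ) :
    Function.Bijective fun p : Fin (n + 1) × Equiv.Perm (Fin n) => snocPerm p.1 p.2 := by
  rw [Fintype.bijective_iff_injective_and_card]
  refine ⟨?_, by simp [Fintype.card_perm, Nat.factorial_succ]⟩
  rintro ⟨v, τ⟩ ⟨w, ρ⟩ h
  have hv : v = w := by simpa using DFunLike.congr_fun h (Fin.last n)
  subst hv
  have : τ = ρ := by
    ext i
    have := DFunLike.congr_fun h i.castSucc
    simpa [Fin.ext_iff] using congrArg Fin.val (Fin.succAbove_right_injective (p := v)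
      (by simpa using this))
  rw [this]

theorem val_succAbove_lt_iff {n : ℕ} (v : Fin (n + 1)) (x : Fin n) (j : ℕ) :
    (v.succAbove x : ℕ) < j ↔ (x : ℕ) < if j ≤ v then j else j - 1 := by
  rw [Fin.succAbove]
  split_ifs with h1 h2 h2 <;> simp [Fin.lt_def] at * <;> omega

theorem isIncBelow_snocPerm_map {n : ℕ} (v : Fin (n + 1)) (τ : Equiv.Perm (Fin n)) (j : ℕ)
    (S : Finset (Fin n)) : IsIncBelow (snocPerm v τ) j (S.map Fin.castSuccEmb) ↔
      IsIncBelow τ (if j ≤ v then j else j - 1) S := by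
  simp [IsIncBelow, StrictMonoOn, val_succAbove_lt_iff]

theorem isIncBelow_snocPerm_insert {n : ℕ} (v : Fin (n + 1)) (τ : Equiv.Perm (Fin n)) (j : ℕ)
    (S : Finset (Fin n)) :
    IsIncBelow (snocPerm v τ) j (insert (Fin.last n) (S.map Fin.castSuccEmb)) ↔
      (v : ℕ) < j ∧ IsIncBelow τ v S := by
  have key (x : Fin n) : v.succAbove (τ x) < v ↔ (τ x : ℕ) < v := by
    have := val_succAbove_lt_iff v (τ x) v
    simpa using this
  simp only [IsIncBelow, StrictMonoOn, Finset.coe_insert, Finset.coe_map, Set.mem_insert_iff,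
    Set.mem_image, Finset.mem_coe, Finset.mem_insert, Finset.mem_map]
  constructor
  · rintro ⟨h1, h2⟩
    refine ⟨by simpa using h2 (Fin.last n) (Or.inl rfl), fun a ha b hb hab => ?_, fun i hi => ?_⟩
    · simpa using h1 (Or.inr ⟨a, ha, rfl⟩) (Or.inr ⟨b, hb, rfl⟩) (by simpa using hab)
    · rw [← key]
      simpa using h1 (Or.inr ⟨i, hi, rfl⟩) (Or.inl rfl) (by simp [Fin.castSucc_lt_last])
  · rintro ⟨hv, h1, h2⟩
    refine ⟨?_, ?_⟩
    · rintro _ (rfl | ⟨a, ha, rfl⟩) _ (rfl | ⟨b, hb, rfl⟩) hab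
      · exact absurd hab (lt_irrefl _)
      · exact absurd hab (by simp [Fin.le_last])
      · simpa [key] using h2 a ha
      · simpa using h1 ha hb (by simpa using hab)
    · rintro _ (rfl | ⟨a, ha, rfl⟩)
      · simpa using hv
      · have := (key a).2 (h2 a ha)
        simp only [Fin.castSuccEmb_apply, snocPerm_castSucc]
        exact lt_trans this hv

theorem lisBelow_snocPerm {n : ℕ} (v : Fin (n + 1)) (τ : Equiv.Perm (Fin n)) (j : ℕ) :
    lisBelow (snocPerm v τ) j = if j ≤ v then lisBelow τ j
      else max (lisBelow τ (j - 1)) (lisBelow τ v + 1) := by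
  apply le_antisymm
  · obtain ⟨S, hS, hc⟩ := exists_isIncBelow_card_eq (snocPerm v τ) j
    rw [← hc]
    set S₀ : Finset (Fin n) := Finset.univ.filter fun i => i.castSucc ∈ S with hS₀
    by_cases hl : Fin.last n ∈ S
    · have hSe : S = insert (Fin.last n) (S₀.map Fin.castSuccEmb) := by
        ext i
        induction i using Fin.lastCases <;> simp [hS₀, hl, Fin.castSucc_ne_last]
      rw [hSe, isIncBelow_snocPerm_insert] at hS
      have := hS.2.card_le
      rw [hSe, Finset.card_insert_of_notMem (by simp [Fin.castSucc_ne_last]), Finset.card_map,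
        if_neg (by omega)]
      omega
    · have hSe : S = S₀.map Fin.castSuccEmb := by
        ext i
        induction i using Fin.lastCases <;> simp [hS₀, hl, Fin.castSucc_ne_last]
      rw [hSe, isIncBelow_snocPerm_map] at hS
      have := hS.card_le
      rw [hSe, Finset.card_map]
      split_ifs at this ⊢ <;> omega
  · have h1 : lisBelow τ (if j ≤ v then j else j - 1) ≤ lisBelow (snocPerm v τ) j := by
      obtain ⟨S, hS, hc⟩ := exists_isIncBelow_card_eq τ (if j ≤ v then j else j - 1)
      have := ((isIncBelow_snocPerm_map v τ j S).2 hS).card_le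
      rwa [Finset.card_map, hc] at this
    split_ifs at h1 ⊢ with hj
    · exact h1
    · obtain ⟨S, hS, hc⟩ := exists_isIncBelow_card_eq τ v
      have := ((isIncBelow_snocPerm_insert v τ j S).2 ⟨by omega, hS⟩).card_le
      rw [Finset.card_insert_of_notMem (by simp [Fin.castSucc_ne_last]), Finset.card_map] at this
      omega

theorem lisBelow_zero {n : ℕ} (τ : Equiv.Perm (Fin n)) : lisBelow τ 0 = 0 := by
  obtain ⟨S, hS, hc⟩ := exists_isIncBelow_card_eq τ 0
  rw [← hc, Finset.card_eq_zero, Finset.eq_empty_iff_forall_notMem]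
  exact fun i hi => absurd (hS.2 i hi) (Nat.not_lt_zero _)

theorem lisBelow_succ {n : ℕ} (τ : Equiv.Perm (Fin n)) (j : ℕ) :
    lisBelow τ j ≤ lisBelow τ (j + 1) ∧ lisBelow τ (j + 1) ≤ lisBelow τ j + 1 := by
  induction n generalizing j with
  | zero =>
    have h (j : ℕ) : lisBelow τ j = 0 := by
      obtain ⟨S, -, hc⟩ := exists_isIncBelow_card_eq τ j
      rw [← hc, Finset.card_eq_zero]
      exact Subsingleton.elim _ _
    simp [h]
  | succ n ih =>
    obtain ⟨v, τ, rfl⟩ : ∃ v ρ, snocPerm v ρ = τ := by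
      obtain ⟨⟨v, ρ⟩, h⟩ := (snocPerm_bijective n).2 τ
      exact ⟨v, ρ, h⟩
    rw [lisBelow_snocPerm, lisBelow_snocPerm]
    have h1 := ih τ j
    have h2 := ih τ (j - 1)
    rcases lt_trichotomy j v with h | h | h
    · rw [if_pos h.le, if_pos (by omega)]; exact h1
    · rw [if_pos h.le, if_neg (by omega), ← h]; simp only [Nat.add_sub_cancel]; omega
    · rw [if_neg (by omega), if_neg (by omega)]
      rw [Nat.sub_add_cancel (by omega)] at h2
      simp only [Nat.add_sub_cancel]; omega

/-- The values at which the function `lisBelow τ` does not jump. -/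
noncomputable def flatSet {n : ℕ} (τ : Equiv.Perm (Fin n)) : Finset ℕ :=
  (Finset.range n).filter fun j => lisBelow τ (j + 1) = lisBelow τ j

theorem mem_flatSet {n : ℕ} {τ : Equiv.Perm (Fin n)} {j : ℕ} :
    j ∈ flatSet τ ↔ j < n ∧ lisBelow τ (j + 1) = lisBelow τ j := by
  simp [flatSet]

theorem lisBelow_add_card_flatSet {n : ℕ} (τ : Equiv.Perm (Fin n)) :
    lisBelow τ n + (flatSet τ).card = n := by
  suffices h : ∀ m, lisBelow τ m +
      ((Finset.range m).filter fun j => lisBelow τ (j + 1) = lisBelow τ j).card = m from h n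
  intro m
  induction m with
  | zero => simp [lisBelow_zero]
  | succ m ih =>
    rw [Finset.range_add_one, Finset.filter_insert]
    have := lisBelow_succ τ m
    split_ifs with h
    · rw [Finset.card_insert_of_notMem (by simp)]; omega
    · omega

theorem lisBelow_eq_iff {n : ℕ} (τ : Equiv.Perm (Fin n)) {v j : ℕ} (hv : v ≤ j) (hj : j ≤ n) :
    lisBelow τ j ≤ lisBelow τ v ↔ ∀ i, v ≤ i → i < j → i ∈ flatSet τ := by
  induction j, hv using Nat.le_induction with
  | base => simp only [le_refl, true_iff]; intros; omega
  | succ j hvj ih =>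
    have ih := ih (by omega)
    have := lisBelow_succ τ j
    have hm : lisBelow τ v ≤ lisBelow τ j :=
      monotone_nat_of_le_succ (fun i => (lisBelow_succ τ i).1) hvj
    constructor
    · intro h i hi hij
      rcases Nat.lt_succ_iff_lt_or_eq.1 hij with h' | rfl
      · exact ih.1 (by omega) i hi h'
      · exact mem_flatSet.2 ⟨by omega, by omega⟩
    · intro h
      have h1 := ih.2 fun i hi hij => h i hi (by omega)
      have h2 := (mem_flatSet.1 (h j hvj (by omega))).2
      omega

theorem mem_flatSet_snocPerm {n : ℕ} (v : Fin (n + 1)) (τ : Equiv.Perm (Fin n)) (j : ℕ) :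
    j ∈ flatSet (snocPerm v τ) ↔ (j < v ∧ j ∈ flatSet τ) ∨ ((v : ℕ) < j ∧ j ≤ n ∧
      (j - 1 ∈ flatSet τ ∨ ∀ i, (v : ℕ) ≤ i → i < j - 1 → i ∈ flatSet τ)) := by
  rw [mem_flatSet, lisBelow_snocPerm, lisBelow_snocPerm]
  have hv := v.2
  rcases lt_trichotomy j v with h | h | h
  · rw [if_pos (by omega), if_pos h.le, mem_flatSet]
    constructor
    · exact fun h' => Or.inl ⟨h, by omega, h'.2⟩
    · rintro (h' | h')
      · exact ⟨by omega, h'.2.2⟩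
      · omega
  · rw [if_neg (by omega), if_pos h.le]
    simp only [Nat.add_sub_cancel, ← h]
    omega
  · obtain ⟨k, rfl⟩ : ∃ k, j = k + 1 := ⟨j - 1, by omega⟩
    rw [if_neg (by omega), if_neg (by omega)]
    simp only [Nat.add_sub_cancel]
    have h1 := lisBelow_succ τ k
    by_cases hk : k + 1 < n + 1
    · rw [← lisBelow_eq_iff τ (by omega) (by omega), mem_flatSet (j := k)]
      have hm : lisBelow τ v ≤ lisBelow τ k :=
        monotone_nat_of_le_succ (fun i => (lisBelow_succ τ i).1) (by omega)
      omega
    · refine iff_of_false (fun h' => hk h'.1) ?_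
      rintro (h' | h')
      · omega
      · exact hk (by omega)

theorem zero_notMem_flatSet {n : ℕ} (τ : Equiv.Perm (Fin n)) : 0 ∉ flatSet τ := by
  induction n with
  | zero => simp [mem_flatSet]
  | succ n ih =>
    obtain ⟨⟨v, ρ⟩, rfl⟩ := (snocPerm_bijective n).2 τ
    simp [mem_flatSet_snocPerm, ih ρ]

/-- The largest number below `w` outside `C`. -/
def prevGap (C : Finset ℕ) (w : ℕ) : ℕ :=
  Nat.findGreatest (· ∉ C) (w - 1)

/-- The set obtained from `C` by deleting `w`, and then the value `prevGap C w`, and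
relabelling. -/
def pullSet (n : ℕ) (C : Finset ℕ) (w : ℕ) : Finset ℕ :=
  (Finset.range n).filter fun j =>
    (j < prevGap C w ∧ j ∈ C) ∨ (prevGap C w ≤ j ∧ j + 1 ∈ C ∧ j + 1 ≠ w)

theorem prevGap_eq_iff {C : Finset ℕ} (hC : 0 ∉ C) {w v : ℕ} :
    v = prevGap C w ↔ v ≤ w - 1 ∧ v ∉ C ∧ ∀ i, v < i → i ≤ w - 1 → i ∈ C := by
  rw [prevGap, eq_comm, Nat.findGreatest_eq_iff]
  constructor
  · rintro ⟨h1, h2, h3⟩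
    refine ⟨h1, ?_, fun i hi hw => not_not.1 (h3 hi hw)⟩
    rcases Nat.eq_zero_or_pos v with rfl | h
    · exact hC
    · exact h2 h.ne'
  · rintro ⟨h1, h2, h3⟩
    exact ⟨h1, fun _ => h2, fun i hi hw => not_not.2 (h3 i hi hw)⟩

theorem flatSet_snocPerm_eq_iff {n : ℕ} {C : Finset ℕ} (hC : C ⊆ Finset.range (n + 1))
    (h0 : 0 ∉ C) (v : Fin (n + 1)) (τ : Equiv.Perm (Fin n)) :
    flatSet (snocPerm v τ) = C ↔
      ∃ w ∈ insert (n + 1) C, (v : ℕ) = prevGap C w ∧ flatSet τ = pullSet n C w := by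
  have hv := v.2
  have hCn (j : ℕ) (h : j ∈ C) : 0 < j ∧ j ≤ n := by
    have := Finset.mem_range.1 (hC h)
    refine ⟨Nat.pos_of_ne_zero ?_, by omega⟩
    rintro rfl
    exact h0 h
  have hDn (j : ℕ) (h : j ∈ flatSet τ) : j < n := (mem_flatSet.1 h).1
  constructor
  · rintro rfl
    have hex : ∃ r, (v : ℕ) ≤ r ∧ r ∉ flatSet τ :=
      ⟨n, by omega, fun h => lt_irrefl _ (hDn _ h)⟩
    classical
    obtain ⟨r, ⟨hvr, hr⟩, hmin⟩ : ∃ r, ((v : ℕ) ≤ r ∧ r ∉ flatSet τ) ∧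
        ∀ i, (v : ℕ) ≤ i → i < r → i ∈ flatSet τ := by
      refine ⟨Nat.find hex, Nat.find_spec hex, fun i hi h => ?_⟩
      have := Nat.find_min hex h
      tauto
    have hrn : r ≤ n := by
      by_contra h
      exact lt_irrefl _ (hDn n (hmin n (by omega) (by omega)))
    have hg : (v : ℕ) = prevGap (flatSet (snocPerm v τ)) (r + 1) := by
      rw [prevGap_eq_iff h0]
      refine ⟨by omega, by simp [mem_flatSet_snocPerm], fun i hi hir => ?_⟩
      rw [mem_flatSet_snocPerm]
      exact Or.inr ⟨hi, by omega, Or.inr fun k hk hki => hmin k hk (by omega)⟩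
    refine ⟨r + 1, ?_, hg, ?_⟩
    · rw [Finset.mem_insert, mem_flatSet_snocPerm]
      by_cases h : r = n
      · exact Or.inl (by omega)
      · exact Or.inr (Or.inr ⟨by omega, by omega, Or.inr fun i hi hir => hmin i hi (by omega)⟩)
    · ext j
      rw [pullSet, ← hg, Finset.mem_filter, Finset.mem_range, mem_flatSet_snocPerm,
        mem_flatSet_snocPerm]
      constructor
      · intro h
        refine ⟨hDn j h, ?_⟩
        have hn := hDn j h
        by_cases hj : j < v
        · exact Or.inl ⟨hj, Or.inl ⟨hj, h⟩⟩
        · refine Or.inr ⟨by omega, Or.inr ⟨by omega, by omega, Or.inl h⟩, ?_⟩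
          intro h'
          obtain rfl : j = r := by omega
          exact hr h
      · rintro ⟨hn, ⟨hj, ⟨-, h⟩ | h⟩ | ⟨hj, h | ⟨-, -, h | h⟩, hne⟩⟩
        · exact h
        · omega
        · omega
        · exact h
        · simp only [Nat.add_sub_cancel] at h
          rcases lt_trichotomy j r with hjr | hjr | hjr
          · exact hmin j hj hjr
          · omega
          · exact absurd (h r hvr hjr) hr
  · rintro ⟨w, hw, hg, hD⟩
    have hw0 : 0 < w := by
      rcases Finset.mem_insert.1 hw with rfl | h
      · omega
      · exact (hCn w h).1
    obtain ⟨hvw, hvC, hmax⟩ := (prevGap_eq_iff h0).1 hg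
    have hDj (j : ℕ) : j ∈ flatSet τ ↔
        j < n ∧ ((j < v ∧ j ∈ C) ∨ ((v : ℕ) ≤ j ∧ j + 1 ∈ C ∧ j + 1 ≠ w)) := by
      rw [hD, pullSet, ← hg, Finset.mem_filter, Finset.mem_range]
    have hr : w - 1 ∉ flatSet τ := by
      rw [hDj]
      omega
    have hrun (i : ℕ) (hi : (v : ℕ) ≤ i) (hiw : i < w - 1) : i ∈ flatSet τ := by
      have := hmax (i + 1) (by omega) (by omega)
      have := hCn _ this
      rw [hDj]
      exact ⟨by omega, Or.inr ⟨hi, by assumption, by omega⟩⟩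
    ext j
    rw [mem_flatSet_snocPerm]
    constructor
    · rintro (⟨hj, h⟩ | ⟨hj, hjn, h | h⟩)
      · have := (hDj j).1 h
        rcases this.2 with h | h
        · exact h.2
        · omega
      · rcases ((hDj _).1 h).2 with h | h
        · omega
        · rw [Nat.sub_add_cancel (by omega)] at h
          exact h.2.1
      · by_cases hjw : j ≤ w - 1
        · exact hmax j hj hjw
        · by_cases hjw' : j = w
          · subst hjw'
            exact (Finset.mem_insert.1 hw).resolve_left (by omega)
          · exact absurd (h (w - 1) hvw (by omega)) hr
    · intro h
      have hb := hCn j h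
      rcases lt_trichotomy j v with hj | hj | hj
      · exact Or.inl ⟨hj, (hDj j).2 ⟨by omega, Or.inl ⟨hj, h⟩⟩⟩
      · exact absurd (hj ▸ h) hvC
      · refine Or.inr ⟨hj, hb.2, ?_⟩
        by_cases hjw : j = w
        · subst hjw
          exact Or.inr fun i hi hij => hrun i hi hij
        · left
          rw [hDj, Nat.sub_add_cancel (by omega)]
          exact ⟨by omega, Or.inr ⟨by omega, h, hjw⟩⟩

/-- The number of permutations with a given flat set. -/
noncomputable def flatCount (n : ℕ) (C : Finset ℕ) : ℕ :=
  (Finset.univ.filter fun τ : Equiv.Perm (Fin n) => flatSet τ = C).card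

theorem flatCount_eq_zero {n : ℕ} {C : Finset ℕ} (h0 : 0 ∈ C) : flatCount n C = 0 := by
  rw [flatCount, Finset.card_eq_zero, Finset.filter_eq_empty_iff]
  rintro τ - rfl
  exact zero_notMem_flatSet τ h0

theorem flatCount_succ {n : ℕ} {C : Finset ℕ} (hC : C ⊆ Finset.range (n + 1)) (h0 : 0 ∉ C) :
    flatCount (n + 1) C = ∑ w ∈ insert (n + 1) C, flatCount n (pullSet n C w) := by
  simp only [flatCount]
  have hw0 : ∀ w ∈ insert (n + 1) C, 0 < w ∧ w ≤ n + 1 := by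
    intro w hw
    rcases Finset.mem_insert.1 hw with rfl | h
    · omega
    · have := Finset.mem_range.1 (hC h)
      refine ⟨Nat.pos_of_ne_zero ?_, by omega⟩
      rintro rfl
      exact h0 h
  have hlt : ∀ w ∈ insert (n + 1) C, prevGap C w < n + 1 := by
    intro w hw
    have := ((prevGap_eq_iff h0 (w := w)).1 rfl).1
    have := hw0 w hw
    omega
  have hne : ∀ w ∈ insert (n + 1) C, ∀ w' ∈ insert (n + 1) C, w < w' →
      prevGap C w = prevGap C w' → pullSet n C w ≠ pullSet n C w' := by
    intro w hw w' hw' hww hp he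
    have h1 := hw0 w hw
    have h2 := hw0 w' hw'
    have hwC : w ∈ C := (Finset.mem_insert.1 hw).resolve_left (by omega)
    have h3 := ((prevGap_eq_iff h0 (w := w)).1 rfl).1
    have : w - 1 ∈ pullSet n C w' := by
      rw [pullSet, Finset.mem_filter, Finset.mem_range, Nat.sub_add_cancel h1.1, ← hp]
      exact ⟨by omega, Or.inr ⟨h3, hwC, by omega⟩⟩
    rw [← he, pullSet, Finset.mem_filter] at this
    omega
  rw [← Finset.card_sigma]
  symm
  refine Finset.card_bij
    (fun p hp => snocPerm ⟨prevGap C p.1, hlt p.1 (Finset.mem_sigma.1 hp).1⟩ p.2) ?_ ?_ ?_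
  · rintro ⟨w, τ⟩ hp
    simp only [Finset.mem_sigma, Finset.mem_filter, Finset.mem_univ, true_and] at hp ⊢
    exact (flatSet_snocPerm_eq_iff hC h0 _ _).2 ⟨w, hp.1, rfl, hp.2⟩
  · rintro ⟨w, τ⟩ hp ⟨w', τ'⟩ hp' he
    simp only [Finset.mem_sigma, Finset.mem_filter, Finset.mem_univ, true_and] at hp hp'
    have h := (snocPerm_bijective n).1 (a₁ := (_, τ)) (a₂ := (_, τ')) he
    simp only [Prod.mk.injEq, Fin.mk.injEq] at h
    obtain ⟨h1, rfl⟩ := h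
    rcases lt_trichotomy w w' with hlt | rfl | hlt
    · exact absurd (hp.2.symm.trans hp'.2) (hne w hp.1 w' hp'.1 hlt h1)
    · rfl
    · exact absurd (hp'.2.symm.trans hp.2) (hne w' hp'.1 w hp.1 hlt h1.symm)
  · intro σ hσ
    obtain ⟨⟨v, τ⟩, rfl⟩ := (snocPerm_bijective n).2 σ
    obtain ⟨w, hw, hv, hτ⟩ := (flatSet_snocPerm_eq_iff hC h0 v τ).1 (by simpa using hσ)
    refine ⟨⟨w, τ⟩, by simpa [hτ] using hw, ?_⟩
    congr 1
    exact Fin.ext hv.symm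

theorem pullSet_eq {n w : ℕ} {C : Finset ℕ} (v : ℕ) (D : Finset ℕ) (h0 : 0 ∉ C)
    (h : ∀ j, (v ≤ w - 1 ∧ v ∉ C ∧ (v < j → j ≤ w - 1 → j ∈ C)) ∧
      (j ∈ D ↔ j < n ∧ ((j < v ∧ j ∈ C) ∨ (v ≤ j ∧ j + 1 ∈ C ∧ j + 1 ≠ w)))) :
    pullSet n C w = D := by
  ext j
  rw [pullSet, ← (prevGap_eq_iff h0).2 ⟨(h 0).1.1, (h 0).1.2.1, fun i => (h i).1.2.2⟩, (h j).2,
    Finset.mem_filter, Finset.mem_range]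

theorem flatCount_empty (n : ℕ) : flatCount n ∅ = 1 := by
  induction n with
  | zero =>
    rw [flatCount, Finset.filter_true_of_mem (fun τ _ => by simp [flatSet])]
    simp
  | succ n ih =>
    rw [flatCount_succ (by simp) (by simp)]
    simp only [insert_empty_eq, Finset.sum_singleton]
    rw [pullSet_eq n ∅ (by simp) (by grind), ih]

theorem flatCount_singleton {n a : ℕ} (ha : a < n) :
    (flatCount n {a} : ℤ) = if 1 ≤ a then (n : ℤ) - 1 else 0 := by
  induction n generalizing a with
  | zero => omega
  | succ n ih =>
    by_cases ha1 : 1 ≤ a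
    · have h0 : 0 ∉ ({a} : Finset ℕ) := by simp only [Finset.mem_singleton]; omega
      rw [flatCount_succ (by simpa using ha) h0,
        Finset.sum_insert (by simp only [Finset.mem_singleton]; omega), Finset.sum_singleton,
        pullSet_eq (w := a) (a - 1) ∅ h0 (by grind), flatCount_empty]
      by_cases han : a = n
      · rw [pullSet_eq (a - 1) {a - 1} h0 (by grind)]
        push_cast
        rw [ih (by omega)]
        split_ifs <;> omega
      · rw [pullSet_eq n {a} h0 (by grind)]
        push_cast
        rw [ih (by omega)]
        split_ifs
        omega
    · rw [flatCount_eq_zero (by simp; omega), if_neg ha1, Nat.cast_zero]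

theorem flatCount_pair {n a b : ℕ} (hab : a < b) (hb : b < n) :
    (flatCount n {a, b} : ℤ) = if 1 ≤ a then
      (if 3 ≤ b then (n.choose 2 : ℤ) - n else 0) + (n.choose 2 - n + 1) else 0 := by
  induction n generalizing a b with
  | zero => omega
  | succ n ih =>
    by_cases ha1 : 1 ≤ a
    · have h0 : 0 ∉ ({a, b} : Finset ℕ) := by
        simp only [Finset.mem_insert, Finset.mem_singleton]; omega
      have hsub : ({a, b} : Finset ℕ) ⊆ Finset.range (n + 1) := by
        intro j
        simp only [Finset.mem_insert, Finset.mem_singleton, Finset.mem_range]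
        omega
      have hp : (n + 1).choose 2 = n + n.choose 2 := by simp [Nat.choose_succ_succ' n 1]
      have hs : (n = 2 → n.choose 2 = 1) ∧ (n = 3 → n.choose 2 = 3) := by
        constructor <;> rintro rfl <;> rfl
      have hA : (flatCount n (pullSet n {a, b} a) : ℤ) = (n : ℤ) - 1 := by
        rw [pullSet_eq (a - 1) {b - 1} h0 fun j => by
            simp only [Finset.mem_insert, Finset.mem_singleton]; omega,
          flatCount_singleton (by omega), if_pos (by omega)]
      have hB : (flatCount n (pullSet n {a, b} b) : ℤ) = if 3 ≤ b then (n : ℤ) - 1 else 0 := by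
        by_cases h : b = a + 1
        · rw [pullSet_eq (a - 1) {a - 1} h0 fun j => by
              simp only [Finset.mem_insert, Finset.mem_singleton]; omega,
            flatCount_singleton (by omega)]
          split_ifs <;> omega
        · rw [pullSet_eq (b - 1) {a} h0 fun j => by
              simp only [Finset.mem_insert, Finset.mem_singleton]; omega,
            flatCount_singleton (by omega)]
          split_ifs <;> omega
      have hT : (flatCount n (pullSet n {a, b} (n + 1)) : ℤ) =
          (if 3 ≤ b then (n.choose 2 : ℤ) - n else 0) + (n.choose 2 - n + 1) := by
        by_cases h1 : b = n
        · by_cases h2 : b = a + 1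
          · rw [pullSet_eq (a - 1) {a - 1, b - 1} h0 fun j => by
                simp only [Finset.mem_insert, Finset.mem_singleton]; omega,
              ih (by omega) (by omega)]
            split_ifs <;> omega
          · rw [pullSet_eq (b - 1) {a, b - 1} h0 fun j => by
                simp only [Finset.mem_insert, Finset.mem_singleton]; omega,
              ih (by omega) (by omega)]
            split_ifs <;> omega
        · rw [pullSet_eq n {a, b} h0 fun j => by
              simp only [Finset.mem_insert, Finset.mem_singleton]; omega,
            ih (by omega) (by omega), if_pos ha1]
      rw [flatCount_succ hsub h0, Finset.sum_insert (by
          simp only [Finset.mem_insert, Finset.mem_singleton]; omega),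
        Finset.sum_pair hab.ne]
      push_cast
      rw [hA, hB, hT, hp]
      split_ifs <;> omega
    · rw [flatCount_eq_zero (by simp; omega), if_neg ha1, Nat.cast_zero]

set_option maxHeartbeats 2000000 in
theorem flatCount_triple {n a b c : ℕ} (hab : a < b) (hbc : b < c) (hc : c < n) :
    (flatCount n {a, b, c} : ℤ) = if 1 ≤ a then
      (if 3 ≤ b ∧ 5 ≤ c then (n.choose 3 : ℤ) - n.choose 2 else 0) +
      (if 3 ≤ b then 2 * (n.choose 3 : ℤ) - 2 * n.choose 2 + n else 0) +
      (if 4 ≤ c then 2 * (n.choose 3 : ℤ) - 2 * n.choose 2 + n else 0) +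
      (n.choose 3 - n.choose 2 + n - 1) else 0 := by
  induction n generalizing a b c with
  | zero => omega
  | succ n ih =>
    by_cases ha1 : 1 ≤ a
    · have h0 : 0 ∉ ({a, b, c} : Finset ℕ) := by
        simp only [Finset.mem_insert, Finset.mem_singleton]; omega
      have hsub : ({a, b, c} : Finset ℕ) ⊆ Finset.range (n + 1) := by
        intro j
        simp only [Finset.mem_insert, Finset.mem_singleton, Finset.mem_range]
        omega
      have hp : (n + 1).choose 2 = n + n.choose 2 := by simp [Nat.choose_succ_succ' n 1]
      have hq : (n + 1).choose 3 = n.choose 2 + n.choose 3 := Nat.choose_succ_succ' n 2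
      have hs : (n = 3 → n.choose 2 = 3 ∧ n.choose 3 = 1) ∧
          (n = 4 → n.choose 2 = 6 ∧ n.choose 3 = 4) ∧
          (n = 5 → n.choose 2 = 10 ∧ n.choose 3 = 10) := by
        refine ⟨?_, ?_, ?_⟩ <;> rintro rfl <;> exact ⟨rfl, rfl⟩
      have hA : (flatCount n (pullSet n {a, b, c} a) : ℤ) =
          (if 4 ≤ c then (n.choose 2 : ℤ) - n else 0) + (n.choose 2 - n + 1) := by
        rw [pullSet_eq (a - 1) {b - 1, c - 1} h0 fun j => by
            simp only [Finset.mem_insert, Finset.mem_singleton]; omega,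
          flatCount_pair (by omega) (by omega)]
        split_ifs <;> omega
      have hB : (flatCount n (pullSet n {a, b, c} b) : ℤ) = if 3 ≤ b then
          (if 4 ≤ c then (n.choose 2 : ℤ) - n else 0) + (n.choose 2 - n + 1) else 0 := by
        by_cases h : b = a + 1
        · rw [pullSet_eq (a - 1) {a - 1, c - 1} h0 fun j => by
              simp only [Finset.mem_insert, Finset.mem_singleton]; omega,
            flatCount_pair (by omega) (by omega)]
          split_ifs <;> omega
        · rw [pullSet_eq (b - 1) {a, c - 1} h0 fun j => by
              simp only [Finset.mem_insert, Finset.mem_singleton]; omega,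
            flatCount_pair (by omega) (by omega)]
          split_ifs <;> omega
      have hC : (flatCount n (pullSet n {a, b, c} c) : ℤ) = if 4 ≤ c then
          (if 3 ≤ b ∧ 5 ≤ c then (n.choose 2 : ℤ) - n else 0) + (n.choose 2 - n + 1) else 0 := by
        by_cases h : c = b + 1
        · by_cases h' : b = a + 1
          · rw [pullSet_eq (a - 1) {a - 1, b - 1} h0 fun j => by
                simp only [Finset.mem_insert, Finset.mem_singleton]; omega,
              flatCount_pair (by omega) (by omega)]
            split_ifs <;> omega
          · rw [pullSet_eq (b - 1) {a, b - 1} h0 fun j => by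
                simp only [Finset.mem_insert, Finset.mem_singleton]; omega,
              flatCount_pair (by omega) (by omega)]
            split_ifs <;> omega
        · rw [pullSet_eq (c - 1) {a, b} h0 fun j => by
              simp only [Finset.mem_insert, Finset.mem_singleton]; omega,
            flatCount_pair (by omega) (by omega)]
          split_ifs <;> omega
      have hT : (flatCount n (pullSet n {a, b, c} (n + 1)) : ℤ) =
          (if 3 ≤ b ∧ 5 ≤ c then (n.choose 3 : ℤ) - n.choose 2 else 0) +
          (if 3 ≤ b then 2 * (n.choose 3 : ℤ) - 2 * n.choose 2 + n else 0) +
          (if 4 ≤ c then 2 * (n.choose 3 : ℤ) - 2 * n.choose 2 + n else 0) +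
          (n.choose 3 - n.choose 2 + n - 1) := by
        by_cases h1 : c = n
        · by_cases h2 : c = b + 1
          · by_cases h3 : b = a + 1
            · rw [pullSet_eq (a - 1) {a - 1, b - 1, c - 1} h0 fun j => by
                  simp only [Finset.mem_insert, Finset.mem_singleton]; omega,
                ih (by omega) (by omega) (by omega)]
              split_ifs <;> omega
            · rw [pullSet_eq (b - 1) {a, b - 1, c - 1} h0 fun j => by
                  simp only [Finset.mem_insert, Finset.mem_singleton]; omega,
                ih (by omega) (by omega) (by omega)]
              split_ifs <;> omega
          · rw [pullSet_eq (c - 1) {a, b, c - 1} h0 fun j => by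
                simp only [Finset.mem_insert, Finset.mem_singleton]; omega,
              ih (by omega) (by omega) (by omega)]
            split_ifs <;> omega
        · rw [pullSet_eq n {a, b, c} h0 fun j => by
              simp only [Finset.mem_insert, Finset.mem_singleton]; omega,
            ih (by omega) (by omega) (by omega), if_pos ha1]
      rw [flatCount_succ hsub h0, Finset.sum_insert (by
          simp only [Finset.mem_insert, Finset.mem_singleton]; omega),
        Finset.sum_insert (by simp only [Finset.mem_insert, Finset.mem_singleton]; omega),
        Finset.sum_pair hbc.ne]
      push_cast
      rw [hA, hB, hC, hT, hp, hq]
      split_ifs <;> omega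
    · rw [flatCount_eq_zero (by simp; omega), if_neg ha1, Nat.cast_zero]

theorem exists_sublist_permSeq_iff {n : ℕ} (σ π : Equiv.Perm (Fin n)) (k : ℕ) :
    (∃ z : List ℕ, z.length = k ∧ z.Sublist (permSeq σ) ∧ z.Sublist (permSeq π)) ↔
      ∃ S : Finset (Fin n), S.card = k ∧ StrictMonoOn (σ⁻¹ * π) (S : Set (Fin n)) := by
  have hlen (τ : Equiv.Perm (Fin n)) : (permSeq τ).length = n := by simp [permSeq]
  constructor
  · rintro ⟨z, rfl, hσ, hπ⟩
    rw [List.sublist_iff_exists_fin_orderEmbedding_get_eq] at hσ hπ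
    obtain ⟨f, hf⟩ := hσ
    obtain ⟨g, hg⟩ := hπ
    have key (i : Fin z.length) :
        (σ⁻¹ * π) (Fin.cast (hlen π) (g i)) = Fin.cast (hlen σ) (f i) := by
      have h := (hf i).symm.trans (hg i)
      simp only [permSeq, List.get_ofFn, Nat.add_right_cancel_iff] at h
      rw [Equiv.Perm.mul_apply, Equiv.Perm.inv_eq_iff_eq]
      exact (Fin.ext h).symm
    refine ⟨Finset.univ.map ⟨fun i => Fin.cast (hlen π) (g i), fun i j h => by simpa using h⟩,
      by simp, ?_⟩
    intro a ha b hb hab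
    simp only [Finset.coe_map, Finset.coe_univ, Set.image_univ, Set.mem_range] at ha hb
    obtain ⟨i, rfl⟩ := ha
    obtain ⟨j, rfl⟩ := hb
    have hij : g i < g j := hab
    change (σ⁻¹ * π) (Fin.cast (hlen π) (g i)) < (σ⁻¹ * π) (Fin.cast (hlen π) (g j))
    rw [key, key]
    simpa using hij
  · rintro ⟨S, rfl, hS⟩
    refine ⟨List.ofFn fun i => (π (S.orderEmbOfFin rfl i) : ℕ) + 1, by simp, ?_, ?_⟩
    · rw [List.sublist_iff_exists_fin_orderEmbedding_get_eq]
      refine ⟨OrderEmbedding.ofStrictMono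
        (fun i => Fin.cast (hlen σ).symm ((σ⁻¹ * π) (S.orderEmbOfFin rfl (i.cast (by simp)))))
        ?_, ?_⟩
      · intro i j hij
        simpa using hS (S.orderEmbOfFin_mem rfl _) (S.orderEmbOfFin_mem rfl _)
          ((S.orderEmbOfFin rfl).strictMono hij)
      · intro i
        simp only [permSeq, List.get_ofFn, Nat.add_right_cancel_iff]
        exact (congrArg Fin.val (σ.apply_symm_apply _)).symm
    · rw [List.sublist_iff_exists_fin_orderEmbedding_get_eq]
      refine ⟨OrderEmbedding.ofStrictMono
        (fun i => Fin.cast (hlen π).symm (S.orderEmbOfFin rfl (i.cast (by simp)))) ?_, ?_⟩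
      · intro i j hij
        simpa using hij
      · intro i
        simp only [permSeq, List.get_ofFn, Nat.add_right_cancel_iff]
        rfl

theorem lcsLen_permSeq {n : ℕ} (σ π : Equiv.Perm (Fin n)) :
    lcsLen (permSeq σ) (permSeq π) = lisBelow (σ⁻¹ * π) n := by
  simp only [lcsLen, exists_sublist_permSeq_iff]
  apply IsGreatest.csSup_eq
  constructor
  · obtain ⟨S, hS, hc⟩ := exists_isIncBelow_card_eq (σ⁻¹ * π) n
    exact ⟨S, hc, hS.1⟩
  · rintro k ⟨S, rfl, hS⟩
    exact IsIncBelow.card_le ⟨hS, fun i _ => Fin.is_lt _⟩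

theorem pdist_eq_card_flatSet {n : ℕ} (σ π : Equiv.Perm (Fin n)) :
    pdist σ π = (flatSet (σ⁻¹ * π)).card := by
  have := lisBelow_add_card_flatSet (σ⁻¹ * π)
  rw [pdist, lcsLen_permSeq]
  omega

theorem ncard_psphere {n : ℕ} (σ : Equiv.Perm (Fin n)) (t : ℕ) :
    (psphere σ t).ncard =
      ∑ k ∈ Finset.range (t + 1), ∑ C ∈ (Finset.range n).powersetCard k, flatCount n C := by
  have h1 : psphere σ t = (σ * ·) '' ↑(Finset.univ.filter fun ρ : Equiv.Perm (Fin n) =>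
      (flatSet ρ).card ∈ Finset.range (t + 1)) := by
    ext π
    simp only [psphere, Set.mem_ofPred_eq, pdist_eq_card_flatSet, Set.mem_image, Finset.coe_filter,
      Finset.mem_univ, true_and, Finset.mem_range, Nat.lt_succ_iff]
    constructor
    · exact fun h => ⟨σ⁻¹ * π, h, by simp⟩
    · rintro ⟨ρ, h, rfl⟩
      simpa using h
  rw [h1, Set.ncard_image_of_injective _ (mul_right_injective σ), Set.ncard_coe_finset,
    Finset.card_eq_sum_card_fiberwise (f := fun ρ => (flatSet ρ).card) (t := Finset.range (t + 1))
      (fun ρ hρ => by simpa using hρ)]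
  refine Finset.sum_congr rfl fun k hk => ?_
  rw [Finset.card_eq_sum_card_fiberwise (f := flatSet) (t := (Finset.range n).powersetCard k)]
  · refine Finset.sum_congr rfl fun C hC => ?_
    rw [flatCount, Finset.filter_filter, Finset.filter_filter]
    congr 1
    ext ρ
    simp only [Finset.mem_filter, Finset.mem_univ, true_and]
    have := (Finset.mem_powersetCard.1 hC).2
    constructor
    · exact fun h => h.2.2
    · rintro rfl
      exact ⟨this.symm ▸ hk, this, rfl⟩
  · intro ρ hρ
    simp only [Finset.coe_filter, Finset.mem_filter, Set.mem_ofPred_eq] at hρ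
    exact Finset.mem_coe.2 (Finset.mem_powersetCard.2 ⟨Finset.filter_subset _ _, hρ.2⟩)

theorem sum_powersetCard_succ_range {M : Type*} [AddCommMonoid M] (f : Finset ℕ → M) (k n : ℕ) :
    ∑ C ∈ (Finset.range n).powersetCard (k + 1), f C =
      ∑ c ∈ Finset.range n, ∑ D ∈ (Finset.range c).powersetCard k, f (insert c D) := by
  induction n with
  | zero => simp [Finset.powersetCard_eq_empty.2 (show (∅ : Finset ℕ).card < k + 1 by simp)]
  | succ n ih =>
    rw [Finset.sum_range_succ, ← ih, Finset.range_add_one,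
      Finset.powersetCard_succ_insert Finset.notMem_range_self, Finset.sum_union, Finset.sum_image]
    · intro C hC D hD h
      have hn : ∀ E ∈ (Finset.range n).powersetCard k, n ∉ E := fun E hE hnE =>
        Finset.notMem_range_self ((Finset.mem_powersetCard.1 hE).1 hnE)
      simpa [Finset.erase_insert (hn C hC), Finset.erase_insert (hn D hD)] using
        congrArg (Finset.erase · n) h
    · rw [Finset.disjoint_left]
      intro C hC hC'
      obtain ⟨D, -, rfl⟩ := Finset.mem_image.1 hC'
      exact Finset.notMem_range_self
        ((Finset.mem_powersetCard.1 hC).1 (Finset.mem_insert_self n D))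

theorem sum_range_ite_one_le (b : ℕ) (x : ℤ) :
    ∑ a ∈ Finset.range b, (if 1 ≤ a then x else 0) = if 1 ≤ b then ((b : ℤ) - 1) * x else 0 := by
  induction b with
  | zero => simp
  | succ b ih =>
    rw [Finset.sum_range_succ, ih]
    rcases b.eq_zero_or_pos with rfl | h
    · simp
    · rw [if_pos (by omega), if_pos (by omega), if_pos (by omega)]
      push_cast
      ring

theorem sum_flatCount_singleton {n : ℕ} (hn : 1 ≤ n) :
    ∑ C ∈ (Finset.range n).powersetCard 1, (flatCount n C : ℤ) = ((n : ℤ) - 1) ^ 2 := by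
  simp only [sum_powersetCard_succ_range _ 0, Finset.powersetCard_zero, Finset.sum_singleton,
    insert_empty_eq]
  rw [Finset.sum_congr rfl fun a ha => flatCount_singleton (Finset.mem_range.1 ha),
    sum_range_ite_one_le, if_pos hn]
  ring

theorem sum_range_pair (c : ℕ) (hc : 3 ≤ c) (x y : ℤ) :
    ∑ b ∈ Finset.range c, ∑ a ∈ Finset.range b,
      (if 1 ≤ a then (if 3 ≤ b then x else 0) + y else 0) =
      ((c.choose 2 : ℤ) - c) * x + (c.choose 2 - c + 1) * y := by
  simp only [sum_range_ite_one_le]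
  induction c, hc using Nat.le_induction with
  | base => simp [Finset.sum_range_succ, Nat.choose]
  | succ c hc ih =>
    have hp : (c + 1).choose 2 = c + c.choose 2 := by simp [Nat.choose_succ_succ' c 1]
    rw [Finset.sum_range_succ, ih, if_pos (by omega), if_pos hc, hp]
    push_cast
    ring

theorem sum_flatCount_pair {n : ℕ} (hn : 3 ≤ n) :
    ∑ C ∈ (Finset.range n).powersetCard 2, (flatCount n C : ℤ) =
      ((n.choose 2 : ℤ) - n) ^ 2 + (n.choose 2 - n + 1) ^ 2 := by
  simp only [sum_powersetCard_succ_range, Finset.powersetCard_zero, Finset.sum_singleton,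
    insert_empty_eq]
  rw [Finset.sum_congr rfl fun b hb => Finset.sum_congr rfl fun a ha => by
    rw [Finset.pair_comm, flatCount_pair (Finset.mem_range.1 ha) (Finset.mem_range.1 hb)],
    sum_range_pair n hn]
  ring

theorem sum_range_triple (n : ℕ) (hn : 5 ≤ n) (x y t : ℤ) :
    ∑ c ∈ Finset.range n, ∑ b ∈ Finset.range c, ∑ a ∈ Finset.range b,
      (if 1 ≤ a then (if 3 ≤ b ∧ 5 ≤ c then x else 0) + (if 3 ≤ b then y else 0) +
        (if 4 ≤ c then y else 0) + t else 0) =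
      ((n.choose 3 : ℤ) - n.choose 2) * x +
      (2 * (n.choose 3 : ℤ) - 2 * n.choose 2 + n) * y +
      ((n.choose 3 : ℤ) - n.choose 2 + n - 1) * t := by
  induction n, hn using Nat.le_induction with
  | base => simp [Finset.sum_range_succ, Nat.choose]; ring
  | succ n hn ih =>
    have hp : (n + 1).choose 2 = n + n.choose 2 := by simp [Nat.choose_succ_succ' n 1]
    have hq : (n + 1).choose 3 = n.choose 2 + n.choose 3 := Nat.choose_succ_succ' n 2
    have hin : ∑ b ∈ Finset.range n, ∑ a ∈ Finset.range b,
        (if 1 ≤ a then (if 3 ≤ b ∧ 5 ≤ n then x else 0) + (if 3 ≤ b then y else 0) +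
          (if 4 ≤ n then y else 0) + t else 0) =
        ((n.choose 2 : ℤ) - n) * (x + y) + (n.choose 2 - n + 1) * (y + t) := by
      rw [← sum_range_pair n (by omega)]
      refine Finset.sum_congr rfl fun b _ => Finset.sum_congr rfl fun a _ => ?_
      simp only [hn, and_true, show 4 ≤ n by omega, if_true]
      split_ifs <;> ring
    rw [Finset.sum_range_succ, ih, hin, hp, hq]
    push_cast
    ring

theorem sum_flatCount_triple {n : ℕ} (hn : 5 ≤ n) :
    ∑ C ∈ (Finset.range n).powersetCard 3, (flatCount n C : ℤ) =
      ((n.choose 3 : ℤ) - n.choose 2) ^ 2 + (2 * (n.choose 3 : ℤ) - 2 * n.choose 2 + n) ^ 2 +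
        (n.choose 3 - n.choose 2 + n - 1) ^ 2 := by
  simp only [sum_powersetCard_succ_range, Finset.powersetCard_zero, Finset.sum_singleton,
    insert_empty_eq]
  rw [Finset.sum_congr rfl fun c hc => Finset.sum_congr rfl fun b hb =>
    Finset.sum_congr rfl fun a ha => by
    rw [show ({c, b, a} : Finset ℕ) = {a, b, c} by ext; simp; tauto,
      flatCount_triple (Finset.mem_range.1 ha) (Finset.mem_range.1 hb) (Finset.mem_range.1 hc)],
    sum_range_triple n hn]
  ring

/-- For `n > 5`,
`|S(σ, 3)| = 1 + (n-1)² + (n(n-3)/2)² + ((n-1)(n-2)/2)² + (n(n-1)(n-5)/6)²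
+ (n(n-2)(n-4)/3)² + ((n-1)(n-2)(n-3)/6)²`. -/
theorem psphere_radius_three_card (n : ℕ) (hn : 5 < n) (σ : Equiv.Perm (Fin n)) :
    (psphere σ 3).ncard =
      1 + (n - 1) ^ 2 + (n * (n - 3) / 2) ^ 2 + ((n - 1) * (n - 2) / 2) ^ 2 +
        (n * (n - 1) * (n - 5) / 6) ^ 2 + (n * (n - 2) * (n - 4) / 3) ^ 2 +
        ((n - 1) * (n - 2) * (n - 3) / 6) ^ 2 := by
  obtain ⟨m, rfl⟩ : ∃ m, n = m + 6 := ⟨n - 6, by omega⟩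
  have hsum := ncard_psphere σ 3
  zify at hsum
  simp only [Finset.sum_range_succ, Finset.sum_range_zero, Finset.powersetCard_zero,
    Finset.sum_singleton, flatCount_empty, sum_flatCount_singleton (n := m + 6) (by omega),
    sum_flatCount_pair (n := m + 6) (by omega), sum_flatCount_triple (n := m + 6) (by omega)]
    at hsum
  have hp : 2 * ((m + 6).choose 2 : ℤ) = (m + 6) * (m + 5) := by
    have := Nat.choose_succ_right_eq (m + 6) 1
    rw [show m + 6 - 1 = m + 5 by omega, Nat.choose_one_right] at this
    zify at this
    linarith
  have hq : 3 * ((m + 6).choose 3 : ℤ) = (m + 6).choose 2 * (m + 4) := by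
    have := Nat.choose_succ_right_eq (m + 6) 2
    rw [show m + 6 - 2 = m + 4 by omega] at this
    zify at this
    linarith
  have hdiv (a d : ℕ) (b : ℤ) (hd : (d : ℤ) ≠ 0) (h : (a : ℤ) = b * d) :
      ((a / d : ℕ) : ℤ) = b := by
    rw [Int.natCast_div, h, Int.mul_ediv_cancel _ hd]
  simp only [Nat.add_sub_assoc (show 1 ≤ 6 by norm_num) m,
    Nat.add_sub_assoc (show 2 ≤ 6 by norm_num) m, Nat.add_sub_assoc (show 3 ≤ 6 by norm_num) m,
    Nat.add_sub_assoc (show 4 ≤ 6 by norm_num) m, Nat.add_sub_assoc (show 5 ≤ 6 by norm_num) m]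
  norm_num only
  set p : ℤ := ((m + 6).choose 2 : ℤ)
  set q : ℤ := ((m + 6).choose 3 : ℤ)
  have h2 := hdiv ((m + 6) * (m + 3)) 2 (p - (m + 6)) (by simp) (by push_cast; linarith)
  have h11 := hdiv ((m + 5) * (m + 4)) 2 (p - (m + 6) + 1) (by simp) (by push_cast; linarith)
  have hq' : 6 * q = (m + 6) * (m + 5) * (m + 4) := by linear_combination 2 * hq + (m + 4) * hp
  have h3 := hdiv ((m + 6) * (m + 5) * (m + 1)) 6 (q - p) (by simp)
    (by push_cast; linear_combination 3 * hp - hq')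
  have h21 := hdiv ((m + 6) * (m + 4) * (m + 2)) 3 (2 * q - 2 * p + (m + 6)) (by simp)
    (by push_cast; linear_combination 3 * hp - hq')
  have h111 := hdiv ((m + 5) * (m + 4) * (m + 3)) 6 (q - p + (m + 6) - 1) (by simp)
    (by push_cast; linear_combination 3 * hp - hq')
  apply Nat.cast_injective (R := ℤ)
  rw [hsum]
  simp only [Nat.cast_add (R := ℤ), Nat.cast_pow, h2, h11, h3, h21, h111]
  push_cast
  ring
end

section
/- Let n and r be positive integers with r dividing n. Then for every σ ∈ S_n, |S(m_e^r, 1)| ≤ |S(m_σ^r, 1)|; that is, among all r-regular multipermutation Ulam spheres of radius 1, the sphere centered at m_e^r has minimal size. -/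
/-- The `r`-regular multipermutation Ulam sphere of radius `t` centered at `m_σ^r`. -/
noncomputable def msphere {n : ℕ} (r : ℕ) (σ : Equiv.Perm (Fin n)) (t : ℕ) :
    Set (Fin n → ℕ) :=
  {m | ∃ π : Equiv.Perm (Fin n), m = mreg r π ∧ mdist (mreg r σ) (mreg r π) ≤ t}

/-- All lists obtained from a list by inserting one `a`. -/
def insertions {α : Type*} [DecidableEq α] (a : α) : List α → Finset (List α)
  | [] => {[a]}
  | c :: u => insert (a :: c :: u) ((insertions a u).image (List.cons c))

/-- The list `w` with its first `b` moved one place to the left. -/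
def shiftFirst {α : Type*} [DecidableEq α] (b : α) (w : List α) : List α :=
  (w.erase b).take (w.idxOf b - 1) ++ b :: (w.erase b).drop (w.idxOf b - 1)

section
variable {α : Type*} [DecidableEq α]

theorem mem_insertions {a : α} {u v : List α} :
    v ∈ insertions a u ↔ ∃ l₁ l₂, u = l₁ ++ l₂ ∧ v = l₁ ++ a :: l₂ := by
  induction u generalizing v with
  | nil => simp [insertions]
  | cons c u ih =>
    simp only [insertions, Finset.mem_insert, Finset.mem_image, ih]
    constructor
    · rintro (rfl | ⟨_, ⟨l₁, l₂, rfl, rfl⟩, rfl⟩)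
      · exact ⟨[], c :: u, rfl, rfl⟩
      · exact ⟨c :: l₁, l₂, rfl, rfl⟩
    · rintro ⟨_ | ⟨d, l₁⟩, l₂, h, rfl⟩
      · left; simp_all
      · simp only [List.cons_append, List.cons.injEq] at h
        obtain ⟨rfl, rfl⟩ := h
        exact Or.inr ⟨_, ⟨l₁, l₂, rfl, rfl⟩, rfl⟩

theorem card_insertions_add_count (a : α) (u : List α) :
    (insertions a u).card + u.count a = u.length + 1 := by
  induction u with
  | nil => simp [insertions]
  | cons c u ih =>
    have himg : ((insertions a u).image (List.cons c)).card = (insertions a u).card :=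
      Finset.card_image_of_injective _ List.cons_injective
    rw [insertions]
    by_cases h : c = a
    · subst h
      rw [Finset.insert_eq_of_mem, himg]
      · simp; omega
      · exact Finset.mem_image_of_mem _ (mem_insertions.2 ⟨[], u, rfl, rfl⟩)
    · rw [Finset.card_insert_of_notMem, himg, List.count_cons_of_ne h]
      · simp; omega
      · simp only [Finset.mem_image, not_exists, not_and]
        intro _ _ h'
        exact h (List.cons.inj h').1

theorem perm_of_mem_insertions_erase {a : α} {w v : List α} (ha : a ∈ w)
    (hv : v ∈ insertions a (w.erase a)) : v.Perm w := by
  obtain ⟨l₁, l₂, h, rfl⟩ := mem_insertions.1 hv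
  exact List.perm_middle.trans (h ▸ (List.perm_cons_erase ha).symm)

theorem self_mem_insertions_erase {a : α} {w : List α} (ha : a ∈ w) :
    w ∈ insertions a (w.erase a) := by
  obtain ⟨l₁, l₂, -, h, h'⟩ := List.exists_erase_eq ha
  exact mem_insertions.2 ⟨l₁, l₂, h', h⟩

theorem shiftFirst_mem_insertions (a : α) (w : List α) :
    shiftFirst a w ∈ insertions a (w.erase a) :=
  mem_insertions.2 ⟨_, _, (List.take_append_drop _ _).symm, rfl⟩

theorem shiftFirst_cons_self (b : α) (t : List α) : shiftFirst b (b :: t) = b :: t := by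
  simp [shiftFirst]

theorem shiftFirst_append {b c : α} {x t : List α} (hx : b ∉ x) (hc : b ≠ c) :
    shiftFirst b (x ++ c :: b :: t) = x ++ b :: c :: t := by
  have h : (x ++ c :: b :: t).idxOf b = x.length + 1 := by
    rw [List.idxOf_append_of_notMem hx, List.idxOf_cons_ne _ hc.symm]; simp
  have h' : (x ++ c :: b :: t).erase b = x ++ c :: t := by
    rw [List.erase_append_right _ hx]; simp [hc.symm]
  simp [shiftFirst, h, h']

theorem mem_of_append_eq_append_cons {β : Type*} {b : β} {p z x y : List β}
    (h : p ++ z = x ++ b :: y) (hl : x.length < p.length) : b ∈ p := by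
  have h1 : (p ++ z)[x.length]? = some b := by rw [h]; simp
  rw [List.getElem?_append_left hl] at h1
  exact List.mem_of_getElem? h1

/-- If `a` first occurs before `b`, a list obtained both by moving the first `a` and by moving the
first `b` is the original one or results from moving the first `b` one place to the left. -/
theorem eq_shiftFirst_of_mem_insertions_of_idxOf_lt {a b : α} {w v : List α}
    (hb : b ∈ w) (hlt : w.idxOf a < w.idxOf b)
    (hva : v ∈ insertions a (w.erase a)) (hvb : v ∈ insertions b (w.erase b)) (hvw : v ≠ w) :
    v = shiftFirst b w := by
  have hab : a ≠ b := by rintro rfl; exact hlt.ne rfl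
  obtain ⟨p, t, hbp, rfl, he⟩ := List.exists_erase_eq hb
  rw [he] at hvb
  have hap : a ∈ p := by
    by_contra hap
    rw [List.idxOf_append_of_notMem hap, List.idxOf_append_of_notMem hbp] at hlt
    simp at hlt
  rw [List.erase_append_left _ hap] at hva
  have hlen := List.length_erase_add_one hap
  have hbe : b ∉ p.erase a := fun h => hbp (List.mem_of_mem_erase h)
  obtain ⟨x, y, hxy, rfl⟩ := mem_insertions.1 hvb
  obtain ⟨x', y', hxy', hv⟩ := mem_insertions.1 hva
  generalize p.erase a = e at *
  have key : (∃ s, e = x' ++ s ∧ y' = s ++ b :: t) ∨ ∃ s, x' = e ++ b :: s ∧ t = s ++ y' := by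
    rcases List.append_eq_append_iff.1 hxy' with ⟨s, rfl, h⟩ | ⟨s, rfl, rfl⟩
    · rcases s with _ | ⟨d, s⟩
      · exact Or.inl ⟨[], by simp, by simpa using h.symm⟩
      · simp only [List.cons_append, List.cons.injEq] at h
        obtain ⟨rfl, rfl⟩ := h
        exact Or.inr ⟨s, rfl, rfl⟩
    · exact Or.inl ⟨s, rfl, rfl⟩
  rcases key with ⟨s', rfl, rfl⟩ | ⟨s', rfl, rfl⟩
  · have hv' : x ++ b :: y = (x' ++ a :: s') ++ b :: t := by simpa using hv
    have hl : (x' ++ a :: s').length = p.length := by simp at hlen ⊢; omega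
    have hbq : b ∉ x' ++ a :: s' := by
      simp only [List.mem_append, List.mem_cons, not_or] at hbe ⊢
      exact ⟨hbe.1, hab.symm, hbe.2⟩
    exfalso
    rcases List.append_eq_append_iff.1 hxy.symm with ⟨s, rfl, rfl⟩ | ⟨s, rfl, rfl⟩
    · rcases s with _ | ⟨d, s⟩
      · simp only [List.append_nil, List.nil_append] at hv' hl hvw
        obtain ⟨h1, h2⟩ := List.append_inj hv' hl.symm
        exact hvw (by simp)
      · exact hbq (mem_of_append_eq_append_cons hv'.symm (by simp at hl ⊢; omega))
    · rw [List.append_assoc] at hv'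
      obtain ⟨h1, h2⟩ := List.append_inj hv' hl.symm
      exact hvw (by simp [h2])
  · have hv' : x ++ b :: y = e ++ b :: (s' ++ a :: y') := by simpa using hv
    rcases List.append_eq_append_iff.1 hxy.symm with ⟨s, rfl, rfl⟩ | ⟨s, rfl, -⟩
    · have hbx : b ∉ x := fun h => hbp (List.mem_append_left _ h)
      obtain rfl : x = e := by
        by_contra hxe
        rcases lt_trichotomy x.length e.length with h | h | h
        · exact hbe (mem_of_append_eq_append_cons hv'.symm h)
        · exact hxe (List.append_inj hv' h).1
        · exact hbx (mem_of_append_eq_append_cons hv' h)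
      obtain ⟨c, rfl⟩ : ∃ c, s = [c] := List.length_eq_one_iff.1 (by simp at hlen; omega)
      have hbc : b ≠ c := by rintro rfl; simp at hbp
      simpa using (shiftFirst_append hbx hbc).symm
    · exact absurd (mem_of_append_eq_append_cons (by simpa using hv') (by omega)) hbp

/-- The lists, other than `w` and `shiftFirst b w`, obtained from `w` by moving its first `b`. -/
def moves (b : α) (w : List α) : Finset (List α) :=
  insertions b (w.erase b) \ {w, shiftFirst b w}

/-- The lists obtained from `w` by moving the first occurrence of some letter. -/
def translocations (w : List α) : Finset (List α) :=
  insert w (w.toFinset.biUnion fun b => moves b w)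

theorem shiftFirst_eq_self_iff {b : α} {w : List α} (hb : b ∈ w) :
    shiftFirst b w = w ↔ w.head? = some b := by
  obtain ⟨p, t, hbp, rfl, -⟩ := List.exists_erase_eq hb
  rcases List.eq_nil_or_concat p with rfl | ⟨q, c, rfl⟩
  · simp [shiftFirst_cons_self]
  · simp only [List.concat_eq_append, List.mem_append, List.mem_singleton, not_or] at hbp
    have h : shiftFirst b (q ++ c :: b :: t) = q ++ b :: c :: t := shiftFirst_append hbp.1 hbp.2
    have h1 : q ++ b :: c :: t ≠ q ++ c :: b :: t := by simp [hbp.2]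
    have h2 : (q ++ c :: b :: t).head? ≠ some b := by
      rcases q with _ | ⟨d, q⟩
      · simpa using Ne.symm hbp.2
      · simp only [List.mem_cons, not_or] at hbp
        simpa using Ne.symm hbp.1.1
    rw [List.concat_eq_append, List.append_assoc]
    exact iff_of_false (fun h' => h1 (h ▸ h')) h2

theorem card_moves {b : α} {w : List α} (hb : b ∈ w) :
    (moves b w).card = w.length + 1 - w.count b - if w.head? = some b then 1 else 2 := by
  have hsub : ({w, shiftFirst b w} : Finset (List α)) ⊆ insertions b (w.erase b) := by
    simp [Finset.insert_subset_iff, self_mem_insertions_erase hb, shiftFirst_mem_insertions]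
  have hpair : ({w, shiftFirst b w} : Finset (List α)).card =
      if w.head? = some b then 1 else 2 := by
    split_ifs with h
    · simp [(shiftFirst_eq_self_iff hb).2 h]
    · exact Finset.card_pair fun h' => h ((shiftFirst_eq_self_iff hb).1 h'.symm)
  have h := card_insertions_add_count b (w.erase b)
  rw [List.count_erase_self, List.length_erase_add_one hb] at h
  have hc := List.count_pos_iff.2 hb
  rw [moves, Finset.card_sdiff_of_subset hsub, hpair]
  congr 1
  omega

theorem pairwiseDisjoint_moves (w : List α) :
    (w.toFinset : Set α).PairwiseDisjoint fun b => moves b w := by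
  intro a ha b hb hab
  simp only [List.coe_toFinset, Set.mem_ofPred_eq] at ha hb
  refine Finset.disjoint_left.2 fun v hva hvb => ?_
  simp only [moves, Finset.mem_sdiff, Finset.mem_insert, Finset.mem_singleton, not_or] at hva hvb
  rcases lt_trichotomy (w.idxOf a) (w.idxOf b) with h | h | h
  · exact hvb.2.2 (eq_shiftFirst_of_mem_insertions_of_idxOf_lt hb h hva.1 hvb.1 hva.2.1)
  · exact hab ((List.idxOf_inj ha).1 h)
  · exact hva.2.2 (eq_shiftFirst_of_mem_insertions_of_idxOf_lt ha h hvb.1 hva.1 hva.2.1)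

/-- The number of translocations of a nonempty list in which all letters occur `r` times. -/
theorem card_translocations {w : List α} (hw : w ≠ []) {r : ℕ} (hr : ∀ b ∈ w, w.count b = r) :
    (translocations w).card =
      w.length + 1 - r - 1 + (w.toFinset.card - 1) * (w.length + 1 - r - 2) + 1 := by
  rw [translocations, Finset.card_insert_of_notMem (by simp [moves]),
    Finset.card_biUnion (pairwiseDisjoint_moves w)]
  obtain ⟨a, u, rfl⟩ := List.exists_cons_of_ne_nil hw
  have ha : a ∈ (a :: u).toFinset := by simp
  have key : ∀ b ∈ (a :: u).toFinset, (moves b (a :: u)).card =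
      (a :: u).length + 1 - r - if a = b then 1 else 2 := fun b hb => by
    rw [card_moves (List.mem_toFinset.1 hb), hr b (List.mem_toFinset.1 hb)]
    simp
  rw [← Finset.add_sum_erase _ _ ha, key a ha, if_pos rfl,
    Finset.sum_congr rfl fun b hb => (key b (Finset.mem_of_mem_erase hb)).trans
      (by rw [if_neg (Finset.ne_of_mem_erase hb).symm]),
    Finset.sum_const, Finset.card_erase_of_mem ha, smul_eq_mul]

theorem exists_common_sublist_of_mem_translocations {w v : List α}
    (hv : v ∈ translocations w) :
    v.Perm w ∧ ∃ z : List α, w.length ≤ z.length + 1 ∧ z.Sublist w ∧ z.Sublist v := by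
  simp only [translocations, moves, Finset.mem_insert, Finset.mem_biUnion, List.mem_toFinset,
    Finset.mem_sdiff] at hv
  rcases hv with rfl | ⟨b, hb, hv, -⟩
  · exact ⟨.refl _, v, by simp⟩
  · refine ⟨perm_of_mem_insertions_erase hb hv, w.erase b, (List.length_erase_add_one hb).ge,
      List.erase_sublist, ?_⟩
    obtain ⟨l₁, l₂, h, rfl⟩ := mem_insertions.1 hv
    rw [h]
    exact (List.Sublist.refl _).append (List.sublist_cons_self _ _)

theorem List.Sublist.exists_eq_append_cons {β : Type*} {z w : List β} (h : z.Sublist w)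
    (hl : z.length + 1 = w.length) : ∃ l₁ a l₂, z = l₁ ++ l₂ ∧ w = l₁ ++ a :: l₂ := by
  induction h with
  | slnil => simp at hl
  | @cons z w a h _ =>
    exact ⟨[], a, w, h.eq_of_length (by simpa using hl), rfl⟩
  | @cons_cons z w a h ih =>
    obtain ⟨l₁, b, l₂, rfl, rfl⟩ := ih (by simpa using hl)
    exact ⟨a :: l₁, b, l₂, rfl, rfl⟩

end

section
variable {α : Type*} [LinearOrder α]

theorem List.SortedLE.erase_append_cons {a : α} {l₁ l₂ : List α}
    (h : (l₁ ++ a :: l₂).SortedLE) : (l₁ ++ a :: l₂).erase a = l₁ ++ l₂ := by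
  refine List.Perm.eq_of_pairwise' (r := (· ≤ ·)) (h.pairwise.sublist List.erase_sublist)
    (h.pairwise.sublist ((List.Sublist.refl _).append (List.sublist_cons_self _ _))) ?_
  simpa using (List.perm_middle (a := a) (l₁ := l₁) (l₂ := l₂)).erase a

/-- A list obtained from a sorted list by moving one letter `a` which is not
among the `moves` of `a` can be obtained by moving a smaller letter. -/
theorem exists_lt_mem_insertions_shiftFirst {a : α} {w : List α} (hw : w.SortedLE) (ha : a ∈ w)
    (hne : shiftFirst a w ≠ w) :
    ∃ c < a, c ∈ w ∧ shiftFirst a w ∈ insertions c (w.erase c) := by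
  obtain ⟨p, t, hap, rfl, -⟩ := List.exists_erase_eq ha
  rcases List.eq_nil_or_concat p with rfl | ⟨q, c, rfl⟩
  · exact absurd (shiftFirst_cons_self a t) hne
  · simp only [List.concat_eq_append, List.mem_append, List.mem_singleton, not_or,
      List.append_assoc, List.cons_append, List.nil_append] at hap hw ⊢
    refine ⟨c, lt_of_le_of_ne ?_ (Ne.symm hap.2), by simp, ?_⟩
    · have := (List.pairwise_append.1 hw.pairwise).2.1
      exact List.rel_of_pairwise_cons this (by simp)
    · rw [shiftFirst_append hap.1 hap.2, hw.erase_append_cons]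
      exact mem_insertions.2 ⟨q ++ [a], t, by simp, by simp⟩

theorem mem_translocations_of_common_sublist {w v z : List α} (hw : w.SortedLE)
    (hvw : v.Perm w) (hz : w.length ≤ z.length + 1) (hzw : z.Sublist w) (hzv : z.Sublist v) :
    v ∈ translocations w := by
  by_cases hne : v = w
  · simp [translocations, hne]
  have hlen := hvw.length_eq
  have hzlt : z.length < w.length := by
    refine lt_of_le_of_ne hzw.length_le fun h => hne ?_
    rw [← hzw.eq_of_length h, hzv.eq_of_length (h.trans hlen.symm)]
  obtain ⟨l₁, a, l₂, rfl, rfl⟩ := hzw.exists_eq_append_cons (by omega)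
  obtain ⟨k₁, b, k₂, hkl, rfl⟩ := hzv.exists_eq_append_cons (by omega)
  obtain rfl : b = a := by
    have h1 : (b :: (l₁ ++ l₂)).Perm (a :: (l₁ ++ l₂)) :=
      by
      simpa [hkl] using List.perm_middle.symm.trans (hvw.trans List.perm_middle)
    by_contra hba
    have h2 := h1.count_eq b
    rw [List.count_cons_self, List.count_cons_of_ne (Ne.symm hba)] at h2
    omega
  set w := l₁ ++ b :: l₂ with hwdef
  set v := k₁ ++ b :: k₂ with hvdef
  have hex : (w.toFinset.filter fun c => v ∈ insertions c (w.erase c)).Nonempty := by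
    refine ⟨b, Finset.mem_filter.2 ⟨by simp [hwdef], ?_⟩⟩
    rw [hwdef, hw.erase_append_cons]
    exact mem_insertions.2 ⟨k₁, k₂, hkl, rfl⟩
  obtain ⟨c, hc, hmin⟩ := Finset.exists_min_image _ id hex
  simp only [Finset.mem_filter, List.mem_toFinset, id, and_imp] at hc hmin
  refine Finset.mem_insert_of_mem (Finset.mem_biUnion.2 ⟨c, List.mem_toFinset.2 hc.1, ?_⟩)
  simp only [moves, Finset.mem_sdiff, Finset.mem_insert, Finset.mem_singleton, not_or]
  refine ⟨hc.2, hne, fun hs => ?_⟩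
  obtain ⟨d, hdc, hd, hvd⟩ := exists_lt_mem_insertions_shiftFirst hw hc.1 (hs ▸ hne)
  exact (hmin d hd (hs ▸ hvd)).not_gt hdc

theorem exists_perm_eq_comp_of_ofFn_perm {n : ℕ} {f g : Fin n → α}
    (h : (List.ofFn f).Perm (List.ofFn g)) : ∃ τ : Equiv.Perm (Fin n), f = g ∘ τ := by
  have hfg : f ∘ Tuple.sort f = g ∘ Tuple.sort g := by
    refine List.ofFn_injective (List.Perm.eq_of_sortedLE
      (List.sortedLE_ofFn_iff.2 (Tuple.monotone_sort f))
      (List.sortedLE_ofFn_iff.2 (Tuple.monotone_sort g)) ?_)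
    exact ((Tuple.sort f).ofFn_comp_perm f).trans (h.trans ((Tuple.sort g).ofFn_comp_perm g).symm)
  refine ⟨Tuple.sort g * (Tuple.sort f)⁻¹, funext fun i => ?_⟩
  simpa using congrFun hfg ((Tuple.sort f)⁻¹ i)

end

theorem bddAbove_commonSublist_length {α : Type*} (x y : List α) :
    BddAbove {k | ∃ z : List α, z.length = k ∧ z.Sublist x ∧ z.Sublist y} :=
  ⟨x.length, by rintro _ ⟨z, rfl, hz, -⟩; exact hz.length_le⟩

theorem le_lcsLen_add_iff {α : Type*} {x y : List α} {k t : ℕ} :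
    k ≤ lcsLen x y + t ↔ ∃ z : List α, k ≤ z.length + t ∧ z.Sublist x ∧ z.Sublist y := by
  constructor
  · intro h
    have hne : {k | ∃ z : List α, z.length = k ∧ z.Sublist x ∧ z.Sublist y}.Nonempty :=
      ⟨0, [], rfl, List.nil_sublist x, List.nil_sublist y⟩
    obtain ⟨z, hz, hzx, hzy⟩ := Nat.sSup_mem hne (bddAbove_commonSublist_length x y)
    refine ⟨z, ?_, hzx, hzy⟩
    rw [hz]
    exact h
  · rintro ⟨z, h, hzx, hzy⟩
    exact h.trans (Nat.add_le_add_right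
      (le_csSup (bddAbove_commonSublist_length x y) ⟨z, rfl, hzx, hzy⟩) t)

theorem ofFn_mreg_perm {n : ℕ} (r : ℕ) (σ : Equiv.Perm (Fin n)) :
    (List.ofFn (mreg r σ)).Perm (List.ofFn (mreg r (1 : Equiv.Perm (Fin n)))) :=
  σ.ofFn_comp_perm (mreg r 1)

theorem mem_msphere_iff {n r t : ℕ} {σ : Equiv.Perm (Fin n)} {m : Fin n → ℕ} :
    m ∈ msphere r σ t ↔ (List.ofFn m).Perm (List.ofFn (mreg r σ)) ∧
      ∃ z : List ℕ, n ≤ z.length + t ∧ z.Sublist (List.ofFn (mreg r σ)) ∧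
        z.Sublist (List.ofFn m) := by
  rw [← le_lcsLen_add_iff]
  constructor
  · rintro ⟨π, rfl, h⟩
    refine ⟨?_, by rw [mdist] at h; omega⟩
    exact (ofFn_mreg_perm r π).trans (ofFn_mreg_perm r σ).symm
  · rintro ⟨hp, h⟩
    obtain ⟨τ, rfl⟩ := exists_perm_eq_comp_of_ofFn_perm hp
    refine ⟨σ * τ, rfl, ?_⟩
    change n - lcsLen _ (List.ofFn (mreg r σ ∘ τ)) ≤ t
    omega

theorem finite_msphere {n : ℕ} (r : ℕ) (σ : Equiv.Perm (Fin n)) (t : ℕ) :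
    (msphere r σ t).Finite :=
  (Set.finite_range (mreg r)).subset fun _ ⟨π, h, _⟩ => ⟨π, h.symm⟩

theorem count_ofFn_mreg {n r : ℕ} (hr : 0 < r) (hdvd : r ∣ n) (σ : Equiv.Perm (Fin n)) {b : ℕ}
    (hb : b ∈ List.ofFn (mreg r σ)) : (List.ofFn (mreg r σ)).count b = r := by
  obtain ⟨k, rfl⟩ := hdvd
  obtain ⟨i, rfl⟩ := (List.mem_ofFn' _ _).1 hb
  have hlt : (σ i : ℕ) / r < k := Nat.div_lt_of_lt_mul (σ i).2
  rw [mreg]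
  generalize (σ i : ℕ) / r = j at hlt
  rw [(ofFn_mreg_perm r σ).count_eq]
  have h : List.ofFn (mreg r (1 : Equiv.Perm (Fin (r * k)))) =
      (List.range (r * k)).map fun i => i / r + 1 := by
    apply List.ext_getElem <;> simp [mreg]
  rw [h, List.count, List.countP_map, List.countP_eq_length_filter,
    ← List.toFinset_card_of_nodup (List.nodup_range.filter _)]
  have h2 : ((List.range (r * k)).filter ((fun x => x == j + 1) ∘ fun i => i / r + 1)).toFinset =
      Finset.Ico (j * r) ((j + 1) * r) := by
    ext x
    simp only [List.toFinset_filter, Finset.mem_filter, List.mem_toFinset, List.mem_range,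
      Function.comp_apply, beq_iff_eq, Nat.add_right_cancel_iff, Finset.mem_Ico]
    rw [Nat.div_eq_iff hr]
    have : (j + 1) * r ≤ r * k := by rw [mul_comm]; exact Nat.mul_le_mul_left _ hlt
    rw [Nat.add_mul] at *
    omega
  rw [h2, Nat.card_Ico, Nat.add_mul]
  omega

/-- The radius-1 sphere centered at `m_e^r` has minimal size:
`|S(m_e^r, 1)| ≤ |S(m_σ^r, 1)|` for every `σ ∈ S_n`. -/
theorem msphere_identity_card_min (n r : ℕ) (hn : 0 < n) (hr : 0 < r) (hdvd : r ∣ n)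
    (σ : Equiv.Perm (Fin n)) :
    (msphere r (1 : Equiv.Perm (Fin n)) 1).ncard ≤ (msphere r σ 1).ncard := by
  set e := List.ofFn (mreg r (1 : Equiv.Perm (Fin n))) with he
  set w := List.ofFn (mreg r σ) with hw
  have hwe : w.Perm e := ofFn_mreg_perm r σ
  have hwl : w.length = n := by simp [hw]
  have hel : e.length = n := by simp [he]
  have hsorted : e.SortedLE := List.sortedLE_ofFn_iff.2 fun i j hij =>
    Nat.add_le_add_right (Nat.div_le_div_right hij) 1
  have hcard : (translocations e).card = (translocations w).card := by
    rw [card_translocations (List.ne_nil_of_length_pos (hel.symm ▸ hn))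
        fun b hb => count_ofFn_mreg hr hdvd 1 hb,
      card_translocations (List.ne_nil_of_length_pos (hwl.symm ▸ hn))
        fun b hb => count_ofFn_mreg hr hdvd σ hb,
      List.toFinset_eq_of_perm _ _ hwe, hwl, hel]
  rw [← Set.ncard_image_of_injective _ List.ofFn_injective,
    ← Set.ncard_image_of_injective (msphere r σ 1) List.ofFn_injective]
  calc (List.ofFn '' msphere r 1 1).ncard
      ≤ ((translocations e : Finset (List ℕ)) : Set (List ℕ)).ncard := by
        refine Set.ncard_le_ncard ?_ (Finset.finite_toSet _)
        rintro _ ⟨m, hm, rfl⟩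
        obtain ⟨hp, z, hz, hze, hzm⟩ := mem_msphere_iff.1 hm
        exact mem_translocations_of_common_sublist hsorted hp (hel.trans_le hz) hze hzm
    _ = ((translocations w : Finset (List ℕ)) : Set (List ℕ)).ncard := by
        rw [Set.ncard_coe_finset, Set.ncard_coe_finset, hcard]
    _ ≤ (List.ofFn '' msphere r σ 1).ncard := by
        refine Set.ncard_le_ncard ?_ ((finite_msphere r σ 1).image _)
        intro v hv
        obtain ⟨hp, z, hz, hzw, hzv⟩ := exists_common_sublist_of_mem_translocations hv
        obtain rfl : v.length = n := hp.length_eq.trans hwl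
        refine ⟨v.get, mem_msphere_iff.2 ?_, List.ofFn_get v⟩
        rw [List.ofFn_get]
        exact ⟨hp, z, hwl.ge.trans hz, hzw, hzv⟩
end
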